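/- arXiv:1510.05245 — 2 statements merged into one kernel-verified Lean document; each statement's English description precedes it below -/
import Mathlib

section
/- Let n, k ≥ 1 and let I be a finite index set partitioned as I = I₀ ∪ I₁ with |I₁| = 2nk. For c > 0, let μ_c be the product probability measure on ℝ^I whose coordinate i has the centered real Gaussian distribution with variance c² if i ∈ I₁ and variance 1 if i ∈ I₀. If δ > 0 satisfies δ ≤ √(nk)/2 and |c − 1| ≤ δ/√(nk), then the total variation distance between μ_c and μ_1 is at most √22 · δ. -/
open MeasureTheory ProbabilityTheory

lemma aux_pi {I : Type*} [Fintype I] (v : I → NNReal) (hv : ∀ i, v i ≠ 0)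
    (s : Set (I → ℝ)) (hs : MeasurableSet s) :
    ((Measure.pi fun i => gaussianReal 0 (v i)) s).toReal
      = ∫ x in s, ∏ i, gaussianPDFReal 0 (v i) (x i) := by
  have hint : Integrable (fun x : I → ℝ => ∏ i, gaussianPDFReal 0 (v i) (x i)) :=
    Integrable.fintype_prod (fun i => integrable_gaussianPDFReal 0 (v i))
  have hnn : ∀ x : I → ℝ, 0 ≤ ∏ i, gaussianPDFReal 0 (v i) (x i) := fun x =>
    Finset.prod_nonneg fun i _ => gaussianPDFReal_nonneg 0 (v i) (x i)
  have key : (Measure.pi fun i => gaussianReal 0 (v i))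
      = (volume : Measure (I → ℝ)).withDensity
        (fun x => ENNReal.ofReal (∏ i, gaussianPDFReal 0 (v i) (x i))) := by
    refine Measure.pi_eq fun t ht => ?_
    rw [withDensity_apply _ (MeasurableSet.univ_pi ht),
      ← ofReal_integral_eq_lintegral_ofReal hint.integrableOn (ae_of_all _ hnn),
      volume_pi, Measure.restrict_pi_pi, integral_fintype_prod_eq_prod,
      ENNReal.ofReal_prod_of_nonneg]
    · refine Finset.prod_congr rfl fun i _ => ?_
      rw [gaussianReal_apply_eq_integral 0 (hv i)]
    · intro i _
      exact integral_nonneg fun x => gaussianPDFReal_nonneg 0 (v i) x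
  rw [key, withDensity_apply _ hs,
      ← ofReal_integral_eq_lintegral_ofReal hint.integrableOn (ae_of_all _ hnn),
      ENNReal.toReal_ofReal (integral_nonneg hnn)]

lemma aux_sqrt_eq (c : ℝ) (hc : 0 < c) (x : ℝ) :
    √(gaussianPDFReal 0 (Real.toNNReal (c ^ 2)) x) * √(gaussianPDFReal 0 1 x)
      = (√(2 * Real.pi * c))⁻¹ * Real.exp (-((1 + c ^ 2) / (4 * c ^ 2)) * x ^ 2) := by
  rw [← Real.sqrt_mul (gaussianPDFReal_nonneg _ _ _)]
  rw [Real.sqrt_eq_iff_mul_self_eq (mul_nonneg (gaussianPDFReal_nonneg _ _ _)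
    (gaussianPDFReal_nonneg _ _ _)) (by positivity)]
  simp only [gaussianPDFReal, Real.coe_toNNReal _ (sq_nonneg c), NNReal.coe_one, mul_one, sub_zero]
  have h1 : √(2 * Real.pi * c ^ 2) = √(2 * Real.pi) * c := by
    rw [Real.sqrt_mul (by positivity), Real.sqrt_sq hc.le]
  have h2 : √(2 * Real.pi * c) * √(2 * Real.pi * c) = 2 * Real.pi * c :=
    Real.mul_self_sqrt (by positivity)
  have h3 : √(2 * Real.pi) * √(2 * Real.pi) = 2 * Real.pi :=
    Real.mul_self_sqrt (by positivity)
  rw [h1]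
  have e1 : ∀ a b p q : ℝ, a⁻¹ * p * (b⁻¹ * q) = (a * b)⁻¹ * (p * q) := by
    intro a b p q; rw [mul_inv]; ring
  rw [e1, e1, ← Real.exp_add, ← Real.exp_add, h2]
  congr 1
  · congr 1; linear_combination c * h3
  · congr 1; field_simp; ring

lemma aux_int (c : ℝ) (hc : 0 < c) :
    ∫ x, √(gaussianPDFReal 0 (Real.toNNReal (c ^ 2)) x) * √(gaussianPDFReal 0 1 x)
      = √(2 * c / (1 + c ^ 2)) := by
  simp_rw [aux_sqrt_eq c hc]
  rw [integral_const_mul, integral_gaussian, ← Real.sqrt_inv, ← Real.sqrt_mul (by positivity)]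
  congr 1
  have := Real.pi_pos
  field_simp
  ring

lemma aux_integrable (c : ℝ) (hc : 0 < c) :
    Integrable fun x => √(gaussianPDFReal 0 (Real.toNNReal (c ^ 2)) x)
      * √(gaussianPDFReal 0 1 x) := by
  simp_rw [aux_sqrt_eq c hc]
  exact (integrable_exp_neg_mul_sq (by positivity)).const_mul _

lemma aux_tv {α : Type*} [MeasurableSpace α] (ν : Measure α) (a b : α → ℝ)
    (ha : Integrable (fun x => a x ^ 2) ν) (hb : Integrable (fun x => b x ^ 2) ν)
    (hab : Integrable (fun x => a x * b x) ν)
    (ha1 : ∫ x, a x ^ 2 ∂ν = 1) (hb1 : ∫ x, b x ^ 2 ∂ν = 1)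
    (δ : ℝ) (hδ : 0 < δ) (hB : 1 - δ ^ 2 ≤ ∫ x, a x * b x ∂ν) (s : Set α) :
    |∫ x in s, a x ^ 2 ∂ν - ∫ x in s, b x ^ 2 ∂ν| ≤ 3 * δ := by
  have hsub : Integrable (fun x => (a x - b x) ^ 2) ν := by
    refine ((ha.add hb).sub (hab.const_mul 2)).congr (ae_of_all _ fun x => ?_)
    simp only [Pi.add_apply, Pi.sub_apply]; ring
  have e1 : ∫ x, (a x - b x) ^ 2 ∂ν = 2 - 2 * ∫ x, a x * b x ∂ν := by
    have : ∀ x, (a x - b x) ^ 2 = a x ^ 2 + b x ^ 2 - 2 * (a x * b x) := fun x => by ring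
    simp_rw [this]
    have hs2 : Integrable (fun x => a x ^ 2 + b x ^ 2) ν := ha.add hb
    rw [integral_sub hs2 (hab.const_mul 2), integral_add ha hb, integral_const_mul,
      ha1, hb1]; ring
  have hadd : Integrable (fun x => (a x + b x) ^ 2) ν := by
    refine ((ha.add hb).add (hab.const_mul 2)).congr (ae_of_all _ fun x => ?_)
    simp only [Pi.add_apply]; ring
  have e2 : ∫ x, (a x + b x) ^ 2 ∂ν = 2 + 2 * ∫ x, a x * b x ∂ν := by
    have : ∀ x, (a x + b x) ^ 2 = a x ^ 2 + b x ^ 2 + 2 * (a x * b x) := fun x => by ring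
    simp_rw [this]
    have hs2 : Integrable (fun x => a x ^ 2 + b x ^ 2) ν := ha.add hb
    rw [integral_add hs2 (hab.const_mul 2), integral_add ha hb, integral_const_mul,
      ha1, hb1]; ring
  have hB1 : ∫ x, a x * b x ∂ν ≤ 1 := by
    have : 0 ≤ ∫ x, (a x - b x) ^ 2 ∂ν := integral_nonneg fun x => sq_nonneg _
    linarith
  rw [← integral_sub ha.integrableOn hb.integrableOn]
  calc |∫ x in s, (a x ^ 2 - b x ^ 2) ∂ν| ≤ ∫ x in s, |a x ^ 2 - b x ^ 2| ∂ν :=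
        abs_integral_le_integral_abs
    _ ≤ ∫ x, |a x ^ 2 - b x ^ 2| ∂ν :=
        setIntegral_le_integral (ha.sub hb).abs (ae_of_all _ fun x => abs_nonneg _)
    _ ≤ ∫ x, (1 / (2 * δ) * (a x - b x) ^ 2 + δ / 2 * (a x + b x) ^ 2) ∂ν := by
        refine integral_mono (ha.sub hb).abs ((hsub.const_mul _).add (hadd.const_mul _)) fun x => ?_
        have h : ∀ u w : ℝ, |u * w| ≤ 1 / (2 * δ) * u ^ 2 + δ / 2 * w ^ 2 := by
          intro u w
          have k1 : 1 / (2 * δ) * u ^ 2 + δ / 2 * w ^ 2 - u * w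
            = 1 / (2 * δ) * (u - δ * w) ^ 2 := by field_simp; ring
          have k2 : 1 / (2 * δ) * u ^ 2 + δ / 2 * w ^ 2 + u * w
            = 1 / (2 * δ) * (u + δ * w) ^ 2 := by field_simp; ring
          have k3 : 0 ≤ 1 / (2 * δ) * (u - δ * w) ^ 2 := by positivity
          have k4 : 0 ≤ 1 / (2 * δ) * (u + δ * w) ^ 2 := by positivity
          rw [abs_le]; constructor <;> linarith
        have := h (a x - b x) (a x + b x)
        have e : (a x - b x) * (a x + b x) = a x ^ 2 - b x ^ 2 := by ring
        rw [e] at this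
        exact this
    _ = 1 / δ * (1 - ∫ x, a x * b x ∂ν) + δ * (1 + ∫ x, a x * b x ∂ν) := by
        rw [integral_add (hsub.const_mul _) (hadd.const_mul _), integral_const_mul,
          integral_const_mul, e1, e2]
        field_simp
    _ ≤ 1 / δ * δ ^ 2 + δ * 2 := by gcongr <;> linarith
    _ = 3 * δ := by field_simp; ring

theorem stmt1 {n k : ℕ} (hn : 1 ≤ n) (hk : 1 ≤ k)
    {I : Type*} [Fintype I] [DecidableEq I]
    (I₀ I₁ : Finset I) (hunion : I₀ ∪ I₁ = Finset.univ) (hdisj : Disjoint I₀ I₁)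
    (hcard : I₁.card = 2 * n * k)
    (μ : ℝ → Measure (I → ℝ))
    (hμ : ∀ c : ℝ, μ c = Measure.pi fun i =>
      gaussianReal 0 (if i ∈ I₁ then Real.toNNReal (c ^ 2) else 1))
    (δ c : ℝ) (hδ : 0 < δ) (hδ' : δ ≤ Real.sqrt (n * k) / 2)
    (hc : 0 < c) (hc1 : |c - 1| ≤ δ / Real.sqrt (n * k))
    (s : Set (I → ℝ)) (hs : MeasurableSet s) :
    |(μ c s).toReal - (μ 1 s).toReal| ≤ Real.sqrt 22 * δ := by

  have hd : ∃ d : I → ℝ, ∀ i, d i = if i ∈ I₁ then c else 1 := ⟨_, fun _ => rfl⟩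
  obtain ⟨d, hd⟩ := hd
  have hdpos : ∀ i, 0 < d i := fun i => by rw [hd]; split_ifs <;> simp [hc]
  have hμc : μ c = Measure.pi fun i => gaussianReal 0 (Real.toNNReal (d i ^ 2)) := by
    rw [hμ]; congr 1; funext i; rw [hd]; split_ifs <;> simp
  have hμ1 : μ 1 = Measure.pi fun _ : I => gaussianReal 0 1 := by
    rw [hμ]; congr 1; funext i; split_ifs <;> simp
  have hvne : ∀ i, Real.toNNReal (d i ^ 2) ≠ 0 := fun i => by
    have := hdpos i
    rw [Ne, Real.toNNReal_eq_zero, not_le]; positivity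
  have sqp : ∀ (v : I → NNReal) (x : I → ℝ), (∏ i, √(gaussianPDFReal 0 (v i) (x i))) ^ 2
      = ∏ i, gaussianPDFReal 0 (v i) (x i) := fun v x => by
    rw [← Finset.prod_pow]
    exact Finset.prod_congr rfl fun i _ => Real.sq_sqrt (gaussianPDFReal_nonneg _ _ _)
  have hint : ∀ v : I → NNReal,
      Integrable (fun x : I → ℝ => (∏ i, √(gaussianPDFReal 0 (v i) (x i))) ^ 2) := fun v => by
    simp_rw [sqp]
    exact Integrable.fintype_prod (fun i => integrable_gaussianPDFReal 0 (v i))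
  have hone : ∀ v : I → NNReal, (∀ i, v i ≠ 0) →
      ∫ x : I → ℝ, (∏ i, √(gaussianPDFReal 0 (v i) (x i))) ^ 2 = 1 := fun v hv => by
    simp_rw [sqp]
    rw [integral_fintype_prod_volume_eq_prod (fun i => gaussianPDFReal 0 (v i))]
    exact Finset.prod_eq_one fun i _ => integral_gaussianPDFReal_eq_one 0 (hv i)
  have hN : (1 : ℝ) ≤ (n : ℝ) * k := by
    have : 1 ≤ n * k := Nat.mul_pos hn hk
    exact_mod_cast this
  have hB : 1 - δ ^ 2 ≤ ∫ x : I → ℝ, (∏ i, √(gaussianPDFReal 0 (Real.toNNReal (d i ^ 2)) (x i)))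
      * ∏ i, √(gaussianPDFReal 0 1 (x i)) := by
    simp_rw [← Finset.prod_mul_distrib]
    rw [integral_fintype_prod_volume_eq_prod
      (fun i y => √(gaussianPDFReal 0 (Real.toNNReal (d i ^ 2)) y) * √(gaussianPDFReal 0 1 y))]
    have e : ∀ i, ∫ y, √(gaussianPDFReal 0 (Real.toNNReal (d i ^ 2)) y) * √(gaussianPDFReal 0 1 y)
        = if i ∈ I₁ then √(2 * c / (1 + c ^ 2)) else 1 := fun i => by
      rw [aux_int _ (hdpos i), hd]
      split_ifs
      · rfl
      · norm_num
    simp_rw [e]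
    rw [Finset.prod_ite_mem, Finset.univ_inter, Finset.prod_const, hcard, mul_assoc, pow_mul,
      Real.sq_sqrt (by positivity)]
    have hq : 0 ≤ 2 * c / (1 + c ^ 2) := by positivity
    refine le_trans ?_ (one_add_mul_sub_le_pow (by linarith) (n * k))
    have e3 : 2 * c / (1 + c ^ 2) - 1 = - ((c - 1) ^ 2 / (1 + c ^ 2)) := by
      field_simp; ring
    have h4 : (c - 1) ^ 2 / (1 + c ^ 2) ≤ (c - 1) ^ 2 :=
      div_le_self (sq_nonneg _) (by nlinarith)
    have h5 : (c - 1) ^ 2 ≤ δ ^ 2 / (n * k) := by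
      have := pow_le_pow_left₀ (abs_nonneg _) hc1 2
      rwa [sq_abs, div_pow, Real.sq_sqrt (by linarith)] at this
    rw [le_div_iff₀ (by linarith)] at h5
    rw [e3]
    push_cast
    nlinarith
  have hab : Integrable fun x : I → ℝ => (∏ i, √(gaussianPDFReal 0 (Real.toNNReal (d i ^ 2)) (x i)))
      * ∏ i, √(gaussianPDFReal 0 1 (x i)) := by
    simp_rw [← Finset.prod_mul_distrib]
    exact Integrable.fintype_prod (f := fun i y =>
      √(gaussianPDFReal 0 (Real.toNNReal (d i ^ 2)) y) * √(gaussianPDFReal 0 1 y))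
      fun i => aux_integrable _ (hdpos i)
  have main := aux_tv (volume : Measure (I → ℝ)) _ _ (hint fun i => Real.toNNReal (d i ^ 2))
    (hint fun _ => 1) hab (hone _ hvne) (hone _ fun _ => one_ne_zero) δ hδ hB s
  simp_rw [sqp] at main
  rw [hμc, hμ1, aux_pi _ hvne s hs, aux_pi (fun _ => 1) (fun _ => one_ne_zero) s hs]
  refine main.trans ?_
  have : (3 : ℝ) ≤ √22 := Real.le_sqrt_of_sq_le (by norm_num)
  gcongr
end

section
/- Let k ≥ 1 and 0 < a ≤ 1, and set x_i = 1 − a + 2a(i−1)/k for i = 1, …, k+1. Let V be the (k+1)×(k+1) Vandermonde matrix with entries V_{i,j} = x_i^{j−1}. Then ‖V^{-1}‖_∞ ≤ (2+a)^k · (k/(2a))^k / (⌊k/2⌋! · ⌈k/2⌉!), where ‖M‖_∞ denotes the maximum absolute row sum of M. -/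
open Matrix

/-- Maximum absolute row sum of a square real matrix. -/
noncomputable def rowSumNorm {d : ℕ} (M : Matrix (Fin d) (Fin d) ℝ) : ℝ :=
  ⨆ i, ∑ j, |M i j|

open Polynomial in
theorem dom_mul {P P' Q Q' : ℝ[X]} (h1 : ∀ n, |P.coeff n| ≤ P'.coeff n)
    (h2 : ∀ n, |Q.coeff n| ≤ Q'.coeff n) : ∀ n, |(P * Q).coeff n| ≤ (P' * Q').coeff n := by
  intro n
  rw [coeff_mul, coeff_mul]
  refine (Finset.abs_sum_le_sum_abs _ _).trans (Finset.sum_le_sum fun p _ => ?_)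
  rw [abs_mul]
  exact mul_le_mul (h1 _) (h2 _) (abs_nonneg _) ((abs_nonneg _).trans (h1 _))

open Polynomial in
theorem dom_lin (c : ℝ) (hc : 0 ≤ c) : ∀ n, |(X - C c : ℝ[X]).coeff n| ≤ (X + C c : ℝ[X]).coeff n := by
  intro n
  rcases n with _ | _ | n
  · simp [abs_of_nonneg hc]
  · simp [coeff_X, coeff_C]
  · simp [coeff_X, coeff_C]

open Polynomial in
theorem dom_pair (c : ℝ) (hc : 0 ≤ c) (hc2 : c ≤ 2) :
    ∀ n, |((X - C c) * (X - C (2 - c)) : ℝ[X]).coeff n| ≤ ((X + 1) ^ 2 : ℝ[X]).coeff n := by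
  intro n
  have e1 : ((X - C c) * (X - C (2 - c)) : ℝ[X]) = X ^ 2 - C 2 * X + C (c * (2 - c)) := by
    simp only [C_sub, C_mul]; ring
  have e2 : ((X + 1) ^ 2 : ℝ[X]) = X ^ 2 + C 2 * X + C 1 := by
    rw [show (C 2 : ℝ[X]) = 2 from rfl, C_1]; ring
  rw [e1, e2]
  simp only [coeff_add, coeff_sub, coeff_C_mul, coeff_X_pow, coeff_X, coeff_C]
  rcases n with _ | _ | _ | n
  · simp only [zero_add]
    norm_num
    rw [abs_of_nonneg (by nlinarith), abs_of_nonneg (by nlinarith)]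
    nlinarith [sq_nonneg (c - 1)]
  · norm_num
  · norm_num
  · simp

open Polynomial in
theorem dom_sym {k : ℕ} (x : Fin (k + 1) → ℝ) (hx0 : ∀ i, 0 ≤ x i)
    (hr : ∀ i, x i.rev = 2 - x i) : ∀ (N : ℕ) (S : Finset (Fin (k + 1))), S.card = N →
    (∀ i ∈ S, i.rev ∈ S) →
    ∀ n, |(∏ j ∈ S, (X - C (x j)) : ℝ[X]).coeff n| ≤ ((X + 1) ^ N : ℝ[X]).coeff n := by
  intro N
  induction N using Nat.strong_induction_on with
  | _ N ih =>
  intro S hS hrev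
  rcases S.eq_empty_or_nonempty with rfl | ⟨i, hi⟩
  · simp at hS
    subst hS
    intro n
    simp only [Finset.prod_empty, pow_zero, coeff_one]
    split_ifs <;> simp
  · by_cases hir : i.rev = i
    · have hx1 : x i = 1 := by have := hr i; rw [hir] at this; linarith
      have hc := Finset.card_erase_add_one hi
      obtain ⟨M, rfl⟩ : ∃ M, N = M + 1 := ⟨_, by rw [← hS, ← hc]⟩
      rw [← Finset.mul_prod_erase _ _ hi, pow_succ', hx1]
      refine dom_mul (by simpa using dom_lin 1 zero_le_one) (ih M (by omega) _ (by omega) ?_)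
      intro j hj
      simp only [Finset.mem_erase] at hj ⊢
      refine ⟨fun h => hj.1 ?_, hrev j hj.2⟩
      rw [← Fin.rev_rev j, h, hir]
    · have hi' : i.rev ∈ S.erase i := Finset.mem_erase.2 ⟨hir, hrev i hi⟩
      have hc := Finset.card_erase_add_one hi
      have hc' := Finset.card_erase_add_one hi'
      obtain ⟨M, rfl⟩ : ∃ M, N = M + 2 := ⟨_, by rw [← hS, ← hc, ← hc']⟩
      rw [← Finset.mul_prod_erase _ _ hi, ← Finset.mul_prod_erase _ _ hi', ← mul_assoc, hr,
        add_comm M 2, pow_add]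
      refine dom_mul (dom_pair _ (hx0 i) (by have := hx0 i.rev; rw [hr] at this; linarith))
        (ih M (by omega) _ (by omega) ?_)
      intro j hj
      simp only [Finset.mem_erase] at hj ⊢
      refine ⟨fun h => hj.2.1 (Fin.rev_injective h), fun h => hj.1 ?_, hrev j hj.2.2⟩
      rw [← h, Fin.rev_rev]

open Polynomial in
theorem dom_erase {k : ℕ} (hk : 1 ≤ k) (x : Fin (k + 1) → ℝ) (hx0 : ∀ i, 0 ≤ x i)
    (hr : ∀ i, x i.rev = 2 - x i) (i : Fin (k + 1)) (n : ℕ) :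
    |(∏ j ∈ Finset.univ.erase i, (X - C (x j)) : ℝ[X]).coeff n| ≤
      ((X + 1) ^ k : ℝ[X]).coeff n + (1 - x i) * ((X + 1) ^ (k - 1) : ℝ[X]).coeff n := by
  have hc : (Finset.univ.erase i).card = k := by simp
  by_cases hir : i.rev = i
  · have hx1 : x i = 1 := by have := hr i; rw [hir] at this; linarith
    rw [hx1]
    have := dom_sym x hx0 hr k (Finset.univ.erase i) hc (by
      intro j hj
      simp only [Finset.mem_erase, Finset.mem_univ, and_true] at hj ⊢
      intro h; apply hj
      rw [← Fin.rev_rev j, h, hir]) n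
    simpa using this
  · have hi' : i.rev ∈ Finset.univ.erase i := Finset.mem_erase.2 ⟨hir, Finset.mem_univ _⟩
    have hc' := Finset.card_erase_add_one hi'
    have h1 := dom_sym x hx0 hr (k - 1) ((Finset.univ.erase i).erase i.rev) (by omega) (by
      intro j hj
      simp only [Finset.mem_erase, Finset.mem_univ, and_true] at hj ⊢
      refine ⟨fun h => hj.2 (Fin.rev_injective h), fun h => hj.1 ?_⟩
      rw [← h, Fin.rev_rev])
    have h2 := dom_mul (dom_lin (x i.rev) (hx0 _)) h1 n
    rw [Finset.mul_prod_erase _ (fun j => (X - C (x j) : ℝ[X])) hi'] at h2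
    refine h2.trans (le_of_eq ?_)
    rw [← coeff_C_mul, ← coeff_add]
    congr 1
    obtain ⟨m, rfl⟩ : ∃ m, k = m + 1 := ⟨k - 1, by omega⟩
    simp only [Nat.add_sub_cancel, hr, C_sub, C_1, show (C 2 : ℝ[X]) = 2 from rfl]
    ring

theorem prod_dist (i : ℕ) : ∀ k, i ≤ k →
    ∏ j ∈ (Finset.range (k + 1)).erase i, |(i : ℝ) - j| = (i.factorial * (k - i).factorial : ℕ) := by
  intro k hk
  induction k, hk using Nat.le_induction with
  | base =>
    have : (Finset.range (i + 1)).erase i = Finset.range i := by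
      ext j; simp; omega
    rw [this, ← Finset.prod_range_reflect, ← Finset.prod_range_add_one_eq_factorial]
    simp only [Nat.sub_self, Nat.factorial_zero, mul_one]
    push_cast
    refine Finset.prod_congr rfl fun j hj => ?_
    have hj := Finset.mem_range.1 hj
    rw [Nat.cast_sub (by omega), Nat.cast_sub (by omega)]
    push_cast
    have e : (i : ℝ) - (i - 1 - j) = j + 1 := by ring
    rw [e, abs_of_nonneg (by positivity)]
  | succ k hk ih =>
    have : (Finset.range (k + 1 + 1)).erase i = insert (k + 1) ((Finset.range (k + 1)).erase i) := by
      ext j; simp; omega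
    rw [this, Finset.prod_insert (by simp), ih, Nat.succ_sub hk, Nat.factorial_succ]
    have h2 : |(i : ℝ) - (k + 1 : ℕ)| = ((k - i + 1 : ℕ) : ℝ) := by
      have : (i : ℝ) ≤ k := by exact_mod_cast hk
      rw [abs_of_nonpos (by push_cast; linarith)]
      push_cast [Nat.cast_sub hk]; ring
    rw [h2]; push_cast; ring

theorem prod_nodes {k : ℕ} (hk : 1 ≤ k) (a : ℝ) (ha0 : 0 < a)
    (x : Fin (k + 1) → ℝ) (hx : ∀ i, x i = 1 - a + 2 * a * (i : ℕ) / k) (i : Fin (k + 1)) :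
    ∏ j ∈ Finset.univ.erase i, |x i - x j| =
      (2 * a / k) ^ k * ((i : ℕ).factorial * (k - i).factorial : ℕ) := by
  have h1 : ∀ j, |x i - x j| = (2 * a / k) * |((i : ℕ) : ℝ) - (j : ℕ)| := by
    intro j
    rw [hx, hx, ← abs_of_nonneg (show 0 ≤ 2 * a / k by positivity), ← abs_mul]
    congr 1; ring
  simp only [h1]
  rw [Finset.prod_mul_distrib, Finset.prod_const, ← prod_dist i k (by omega)]
  congr 1
  · simp
  · refine Finset.prod_bij (fun j _ => (j : ℕ)) ?_ ?_ ?_ ?_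
    · intro j hj
      simp only [Finset.mem_erase, Finset.mem_univ, and_true, Finset.mem_range] at hj ⊢
      exact ⟨fun h => hj (Fin.ext h), j.2⟩
    · intro j _ l _ h; exact Fin.ext h
    · intro b hb
      simp only [Finset.mem_erase, Finset.mem_range] at hb
      refine ⟨⟨b, hb.2⟩, ?_, rfl⟩
      simp only [Finset.mem_erase, Finset.mem_univ, and_true]
      intro h; apply hb.1; rw [← h]
    · intro j _; rfl

open Polynomial in
theorem vand_inv {k : ℕ} (x : Fin (k + 1) → ℝ) (hinj : Function.Injective x) :
    (Matrix.vandermonde x)⁻¹ =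
      Matrix.of fun n i : Fin (k + 1) => (Lagrange.basis Finset.univ x i).coeff n := by
  apply Matrix.inv_eq_right_inv
  ext l i
  rw [Matrix.mul_apply, Matrix.one_apply]
  simp only [Matrix.vandermonde_apply, Matrix.of_apply]
  have hd : (Lagrange.basis Finset.univ x i).natDegree < k + 1 := by
    rw [natDegree_lt_iff_degree_lt (Lagrange.basis_ne_zero hinj.injOn (Finset.mem_univ i)),
      Lagrange.degree_basis hinj.injOn (Finset.mem_univ i)]
    simp only [Finset.card_univ, Fintype.card_fin, Nat.add_sub_cancel]
    exact_mod_cast Nat.lt_succ_self k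
  have : (Lagrange.basis Finset.univ x i).eval (x l) =
      ∑ j : Fin (k + 1), x l ^ (j : ℕ) * (Lagrange.basis Finset.univ x i).coeff j := by
    rw [eval_eq_sum_range' hd, ← Fin.sum_univ_eq_sum_range
      (fun j => (Lagrange.basis Finset.univ x i).coeff j * x l ^ j)]
    exact Finset.sum_congr rfl fun j _ => mul_comm _ _
  rw [← this]
  split_ifs with h
  · subst h; exact Lagrange.eval_basis_self hinj.injOn (Finset.mem_univ _)
  · exact Lagrange.eval_basis_of_ne (Ne.symm h) (Finset.mem_univ _)

open Polynomial in
theorem basis_eq {k : ℕ} (x : Fin (k + 1) → ℝ) (i : Fin (k + 1)) (n : ℕ) :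
    |(Lagrange.basis Finset.univ x i).coeff n| =
      (∏ j ∈ Finset.univ.erase i, |x i - x j|)⁻¹ *
        |(∏ j ∈ Finset.univ.erase i, (X - C (x j)) : ℝ[X]).coeff n| := by
  simp only [Lagrange.basis, Lagrange.basisDivisor]
  rw [Finset.prod_mul_distrib, ← map_prod, coeff_C_mul, abs_mul, Finset.abs_prod,
    ← Finset.prod_inv_distrib]
  simp only [abs_inv]

theorem stmt15 {k : ℕ} (hk : 1 ≤ k) (a : ℝ) (ha0 : 0 < a) (ha1 : a ≤ 1)
    (x : Fin (k + 1) → ℝ) (hx : ∀ i, x i = 1 - a + 2 * a * (i : ℕ) / k) :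
    rowSumNorm (Matrix.vandermonde x)⁻¹ ≤
      (2 + a) ^ k * ((k : ℝ) / (2 * a)) ^ k /
        ((Nat.factorial (k / 2) : ℝ) * (Nat.factorial ((k + 1) / 2) : ℝ)) := by
  have hk0 : (0 : ℝ) < k := by exact_mod_cast hk
  have hx0 : ∀ i, 0 ≤ x i := by
    intro i
    rw [hx]
    have : 0 ≤ 2 * a * ((i : ℕ) : ℝ) / k := by positivity
    linarith
  have hr : ∀ i : Fin (k + 1), x i.rev = 2 - x i := by
    intro i
    have h : ((i.rev : ℕ) : ℝ) = k - (i : ℕ) := by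
      rw [Fin.val_rev, Nat.cast_sub (by omega)]; push_cast; ring
    rw [hx, hx, h]; field_simp; ring
  have hinj : Function.Injective x := by
    intro i j h
    rw [hx, hx] at h
    have h2 : ((i : ℕ) : ℝ) = (j : ℕ) := by
      field_simp at h
      nlinarith [h]
    exact Fin.ext (by exact_mod_cast h2)
  unfold rowSumNorm
  refine ciSup_le fun n => ?_
  rw [vand_inv x hinj]
  simp only [Matrix.of_apply]
  have hfac : (0 : ℝ) < k.factorial := by positivity
  have hterm : ∀ i : Fin (k + 1), |(Lagrange.basis Finset.univ x i).coeff n| ≤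
      ((k : ℝ) / (2 * a)) ^ k / k.factorial * ((k.choose i : ℝ) *
        ((k.choose n : ℝ) + (1 - x i) * ((k - 1).choose n : ℝ))) := by
    intro i
    rw [basis_eq, prod_nodes hk a ha0 x hx]
    have h := dom_erase hk x hx0 hr i n
    rw [Polynomial.coeff_X_add_one_pow, Polynomial.coeff_X_add_one_pow] at h
    have hch : (k.choose i : ℝ) * ((i : ℕ).factorial * (k - i).factorial : ℕ) = k.factorial := by
      rw [← Nat.choose_mul_factorial_mul_factorial (show (i : ℕ) ≤ k by omega)]
      push_cast; ring
    have e : ((2 * a / k) ^ k * (((i : ℕ).factorial * (k - i).factorial : ℕ) : ℝ))⁻¹ =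
        ((k : ℝ) / (2 * a)) ^ k / k.factorial * (k.choose i : ℝ) := by
      have : (0 : ℝ) < (((i : ℕ).factorial * (k - i).factorial : ℕ) : ℝ) := by
        exact_mod_cast Nat.mul_pos (Nat.factorial_pos _) (Nat.factorial_pos _)
      have hc0 : (0 : ℝ) < k.choose i := by exact_mod_cast Nat.choose_pos (by omega)
      rw [← hch, mul_inv, ← inv_pow, inv_div]
      field_simp
    rw [e, ← mul_assoc]
    exact mul_le_mul_of_nonneg_left h (by positivity)
  refine (Finset.sum_le_sum fun i _ => hterm i).trans ?_
  rw [← Finset.mul_sum]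
  have hs0 : ∑ i : Fin (k + 1), (k.choose i : ℝ) * (1 - x i) = 0 := by
    have h1 : ∑ i : Fin (k + 1), (k.choose i : ℝ) * (1 - x i) =
        ∑ i : Fin (k + 1), -((k.choose i : ℝ) * (1 - x i)) := by
      rw [← Equiv.sum_comp Fin.revPerm]
      refine Finset.sum_congr rfl fun i _ => ?_
      rw [Fin.revPerm_apply, hr, Fin.val_rev, show k + 1 - ((i : ℕ) + 1) = k - i by omega,
        Nat.choose_symm (by omega)]
      ring
    rw [Finset.sum_neg_distrib] at h1
    linarith
  have hs1 : ∑ i : Fin (k + 1), (k.choose i : ℝ) = 2 ^ k := by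
    rw [Fin.sum_univ_eq_sum_range (fun i => (k.choose i : ℝ))]
    exact_mod_cast Nat.sum_range_choose k
  have hs : ∑ i : Fin (k + 1), ((k.choose i : ℝ) *
        ((k.choose n : ℝ) + (1 - x i) * ((k - 1).choose n : ℝ))) = 2 ^ k * k.choose n := by
    simp only [mul_add, ← mul_assoc]
    rw [Finset.sum_add_distrib, ← Finset.sum_mul, ← Finset.sum_mul, hs0, hs1]
    ring
  rw [hs]
  have hmid : (k.choose (k / 2) : ℝ) * ((k / 2).factorial * ((k + 1) / 2).factorial) =
      k.factorial := by
    rw [← Nat.choose_mul_factorial_mul_factorial (show k / 2 ≤ k by omega),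
      show k - k / 2 = (k + 1) / 2 by omega]
    push_cast; ring
  have hle : (k.choose n : ℝ) ≤ k.choose (k / 2) := by exact_mod_cast Nat.choose_le_middle _ _
  have hc0 : (0 : ℝ) < k.choose (k / 2) := by exact_mod_cast Nat.choose_pos (by omega)
  have h2 : (2 : ℝ) ^ k ≤ (2 + a) ^ k := pow_le_pow_left₀ (by norm_num) (by linarith) k
  calc _ ≤ ((k : ℝ) / (2 * a)) ^ k / k.factorial * ((2 + a) ^ k * k.choose (k / 2)) := by
        gcongr
    _ = _ := by
        rw [← hmid]
        field_simp
end
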